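/- Let ρ₁, ρ₂ : ℝ → [0,1] be smooth, compactly supported functions. Then there exists a constant C = C(ρ₁, ρ₂) such that for all real L, L' ≥ 1 and all ψ ∈ ℝ: |∑_{ℓ ∈ ℤ} ∑_{ℓ' ∈ ℤ} ρ₁(ℓ/L) ρ₂(ℓ'/L') e(ℓψ) e(√2 ℓ ℓ')| ≤ C (L + L'). -/

import Mathlib

/-- `e(θ) = e^{2πiθ}`. -/
noncomputable def eC (θ : ℝ) : ℂ := Complex.exp (2 * Real.pi * Complex.I * θ)

lemma eC_mul_intCast (α : ℝ) (n : ℤ) : eC (α * n) = eC α ^ n := by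
  unfold eC
  rw [← Complex.exp_int_mul]
  congr 1
  push_cast
  ring

lemma norm_eC (α : ℝ) : ‖eC α‖ = 1 := by
  have h : eC α = Complex.exp ((2 * Real.pi * α : ℝ) * Complex.I) := by
    unfold eC
    congr 1
    push_cast
    ring
  rw [h, Complex.norm_exp_ofReal_mul_I]

/-- Lower bound for `‖e(α) + e(-α) - 2‖` in terms of the distance from `α` to the nearest integer. -/
lemma le_norm_eC_add_inv_sub_two (α : ℝ) :
    16 * (α - round α) ^ 2 ≤ ‖eC α + (eC α)⁻¹ - 2‖ := by
  have h : eC α + (eC α)⁻¹ - 2 = ((2 * Real.cos (2 * Real.pi * α) - 2 : ℝ) : ℂ) := by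
    have h2 := Complex.two_cos (2 * Real.pi * α : ℂ)
    unfold eC
    rw [← Complex.exp_neg]
    push_cast
    rw [h2]
    congr 3 <;> ring
  have hcos : Real.cos (2 * Real.pi * α) = Real.cos (2 * Real.pi * (α - round α)) := by
    rw [← Real.cos_sub_int_mul_two_pi _ (round α)]
    congr 1
    ring
  have hle : |2 * Real.pi * (α - round α)| ≤ Real.pi := by
    rw [abs_mul, abs_of_pos (by positivity : 0 < 2 * Real.pi)]
    nlinarith [abs_sub_round α, Real.pi_pos]
  have hq := Real.cos_le_one_sub_mul_cos_sq hle
  have hpi : 2 / Real.pi ^ 2 * (2 * Real.pi * (α - round α)) ^ 2 = 8 * (α - round α) ^ 2 := by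
    field_simp
    ring
  rw [h, Complex.norm_real, Real.norm_eq_abs, hcos, abs_of_nonpos] <;>
    nlinarith [Real.cos_le_one (2 * Real.pi * (α - round α))]

/-- Summation by parts, twice. -/
lemma mul_tsum_zpow_eq_tsum_second_difference {f : ℤ → ℂ} (hf : f.support.Finite) {z : ℂ}
    (hz : z ≠ 0) :
    (z + z⁻¹ - 2) * ∑' n : ℤ, f n * z ^ n =
      ∑' n : ℤ, (f (n + 1) + f (n - 1) - 2 * f n) * z ^ n := by
  have hs : Summable fun n : ℤ => f n * z ^ n :=
    summable_of_hasFiniteSupport (hf.subset (Function.support_mul_subset_left _ _))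
  have h1 : HasSum (fun n : ℤ => f (n + 1) * z ^ n) (z⁻¹ * ∑' n : ℤ, f n * z ^ n) := by
    have := ((Equiv.addRight (1 : ℤ)).hasSum_iff.mpr hs.hasSum).mul_left z⁻¹
    refine this.congr_fun fun n => ?_
    simp only [Function.comp, Equiv.coe_addRight, zpow_add_one₀ hz]
    field_simp
  have h2 : HasSum (fun n : ℤ => f (n - 1) * z ^ n) (z * ∑' n : ℤ, f n * z ^ n) := by
    have := ((Equiv.subRight (1 : ℤ)).hasSum_iff.mpr hs.hasSum).mul_left z
    refine this.congr_fun fun n => ?_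
    simp only [Function.comp, Equiv.subRight_apply, zpow_sub_one₀ hz]
    field_simp
  have h := (h1.add h2).sub (hs.hasSum.mul_left 2)
  rw [show (z + z⁻¹ - 2) * ∑' n : ℤ, f n * z ^ n = z⁻¹ * ∑' n : ℤ, f n * z ^ n +
    z * ∑' n : ℤ, f n * z ^ n - 2 * ∑' n : ℤ, f n * z ^ n by ring, ← h.tsum_eq]
  congr 1
  ext n
  ring

lemma HasCompactSupport.exists_forall_lt_abs_eq_zero {f : ℝ → ℝ} (hf : HasCompactSupport f) :
    ∃ A : ℝ, 1 ≤ A ∧ ∀ x, A < |x| → f x = 0 := by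
  obtain ⟨R, hR⟩ := hf.isCompact.isBounded.subset_closedBall 0
  refine ⟨max R 1, le_max_right _ _, fun x hx => ?_⟩
  by_contra h
  have := hR (subset_tsupport f h)
  rw [mem_closedBall_zero_iff, Real.norm_eq_abs] at this
  exact absurd ((le_max_left R 1).trans_lt hx) this.not_gt

/-- A `C²` function of compact support has second differences of quadratic size. -/
lemma exists_abs_second_difference_le {ρ : ℝ → ℝ} (hρ : ContDiff ℝ 2 ρ)
    (hs : HasCompactSupport ρ) :
    ∃ K : ℝ, 0 ≤ K ∧ ∀ x h : ℝ, |ρ (x + h) + ρ (x - h) - 2 * ρ x| ≤ K * h ^ 2 := by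
  have hd : ContDiff ℝ 1 (deriv ρ) := (contDiff_succ_iff_deriv (n := 1).mp hρ).2.2
  have hdiff : Differentiable ℝ ρ := hρ.differentiable (by norm_num)
  obtain ⟨K, hK⟩ := hd.lipschitzWith_of_hasCompactSupport hs.deriv one_ne_zero
  refine ⟨K, K.2, fun x h => ?_⟩
  have hda : ∀ t, HasDerivAt (fun t => ρ (t + h) - ρ t) (deriv ρ (t + h) - deriv ρ t) t :=
    fun t => ((hdiff (t + h)).hasDerivAt.comp_add_const t h).sub (hdiff t).hasDerivAt
  have := Convex.norm_image_sub_le_of_norm_hasDerivWithin_le (C := K * |h|)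
    (fun t _ => (hda t).hasDerivWithinAt)
    (fun t _ => by
      have := hK.dist_le_mul (t + h) t
      simpa [Real.dist_eq] using this) convex_univ (Set.mem_univ (x - h)) (Set.mem_univ x)
  simp only [Real.norm_eq_abs, sub_add_cancel, sub_sub_cancel] at this
  rw [mul_assoc, abs_mul_abs_self, ← sq] at this
  convert this using 2
  ring

lemma card_Icc_neg_floor_le {B : ℝ} (hB : 0 ≤ B) :
    ((Finset.Icc (-⌊B⌋) ⌊B⌋).card : ℝ) ≤ 2 * B + 1 := by
  have h0 : 0 ≤ ⌊B⌋ := Int.floor_nonneg.mpr hB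
  have h : ((Finset.Icc (-⌊B⌋) ⌊B⌋).card : ℤ) = 2 * ⌊B⌋ + 1 := by
    rw [Int.card_Icc, Int.toNat_of_nonneg (by omega)]
    ring
  have h' : ((Finset.Icc (-⌊B⌋) ⌊B⌋).card : ℝ) = 2 * ⌊B⌋ + 1 := by exact_mod_cast h
  linarith [Int.floor_le B]

lemma lt_abs_of_notMem_Icc_floor {B : ℝ} {n : ℤ} (hn : n ∉ Finset.Icc (-⌊B⌋) ⌊B⌋) :
    B < |(n : ℝ)| := by
  by_contra! h
  refine hn (Finset.mem_Icc.mpr (abs_le.mp (Int.le_floor.mpr ?_)))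
  push_cast
  exact h

lemma norm_tsum_mul_zpow_le {g : ℤ → ℂ} {z : ℂ} (hz : ‖z‖ = 1) {B D : ℝ} (hB : 0 ≤ B)
    (hg : ∀ n : ℤ, B < |(n : ℝ)| → g n = 0) (hD : ∀ n, ‖g n‖ ≤ D) :
    ‖∑' n : ℤ, g n * z ^ n‖ ≤ (2 * B + 1) * D := by
  rw [tsum_eq_sum (s := Finset.Icc (-⌊B⌋) ⌊B⌋)
    (fun n hn => by rw [hg n (lt_abs_of_notMem_Icc_floor hn), zero_mul])]
  refine (norm_sum_le_of_le (f := fun n : ℤ => g n * z ^ n) _ (n := fun _ => D)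
    fun n _ => ?_).trans ?_
  · simpa [hz] using hD n
  · rw [Finset.sum_const, nsmul_eq_mul]
    exact mul_le_mul_of_nonneg_right (card_Icc_neg_floor_le hB) ((norm_nonneg _).trans (hD 0))

/-- A smoothed geometric sum of length `M` is `O(M / (1 + M² ‖α‖²))`. -/
lemma exists_norm_smooth_exponential_sum_le {ρ : ℝ → ℝ} (hρ : ContDiff ℝ 2 ρ)
    (hs : HasCompactSupport ρ) (hr : ∀ x, |ρ x| ≤ 1) :
    ∃ C : ℝ, 0 ≤ C ∧ ∀ M : ℝ, 1 ≤ M → ∀ α : ℝ,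
      ‖∑' n : ℤ, (ρ (n / M) : ℂ) * eC α ^ n‖ ≤ C * (M / (1 + (M * (α - round α)) ^ 2)) := by
  obtain ⟨A, hA1, hA⟩ := hs.exists_forall_lt_abs_eq_zero
  obtain ⟨K, hK0, hK⟩ := exists_abs_second_difference_le hρ hs
  refine ⟨(2 * A + 3) * (1 + K), by positivity, fun M hM α => ?_⟩
  have hM0 : 0 < M := by linarith
  have hvan : ∀ n : ℤ, A * M < |(n : ℝ)| → (ρ (n / M) : ℂ) = 0 := fun n hn => by
    rw [hA _ (by rwa [abs_div, abs_of_pos hM0, lt_div_iff₀ hM0]), Complex.ofReal_zero]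
  have hz := norm_eC α
  have hz0 : eC α ≠ 0 := by
    rw [← norm_ne_zero_iff, hz]
    exact one_ne_zero
  set S := ∑' n : ℤ, (ρ (n / M) : ℂ) * eC α ^ n with hS
  have htriv : ‖S‖ ≤ (2 * (A * M) + 1) * 1 :=
    norm_tsum_mul_zpow_le hz (by positivity) hvan fun n => by
      rw [Complex.norm_real]
      exact hr _
  have hfin : (Function.support fun n : ℤ => (ρ (n / M) : ℂ)).Finite :=
    (Finset.finite_toSet (Finset.Icc (-⌊A * M⌋) ⌊A * M⌋)).subset fun n hn => by
      by_contra h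
      exact hn (hvan n (lt_abs_of_notMem_Icc_floor h))
  have hparts := mul_tsum_zpow_eq_tsum_second_difference hfin hz0
  have hdiff : ‖(eC α + (eC α)⁻¹ - 2) * S‖ ≤ (2 * (A * M + 1) + 1) * (K * (1 / M) ^ 2) := by
    rw [hS, hparts]
    refine norm_tsum_mul_zpow_le hz (by positivity) (fun n hn => ?_) fun n => ?_
    · have h1 : A * M < |((n + 1 : ℤ) : ℝ)| := by
        have := abs_sub_abs_le_abs_sub (n : ℝ) ((n + 1 : ℤ) : ℝ)
        have h' : |(n : ℝ) - ((n + 1 : ℤ) : ℝ)| = 1 := by push_cast; simp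
        linarith
      have h2 : A * M < |((n - 1 : ℤ) : ℝ)| := by
        have := abs_sub_abs_le_abs_sub (n : ℝ) ((n - 1 : ℤ) : ℝ)
        have h' : |(n : ℝ) - ((n - 1 : ℤ) : ℝ)| = 1 := by push_cast; simp
        linarith
      rw [hvan _ h1, hvan _ h2, hvan n (by linarith)]
      simp
    · have := hK (n / M) (1 / M)
      rw [← add_div, ← sub_div] at this
      rw [← Real.norm_eq_abs, ← Complex.norm_real] at this
      simpa using this
  rw [norm_mul] at hdiff
  have hlow := mul_le_mul_of_nonneg_right (le_norm_eC_add_inv_sub_two α) (norm_nonneg S)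
  set θ := α - round α
  have h1 : ‖S‖ ≤ (2 * A + 3) * M := by nlinarith
  have h2 : ‖S‖ * (M * θ) ^ 2 ≤ (2 * A + 3) * K * M := by
    have e : 16 * θ ^ 2 * ‖S‖ * M ^ 2 ≤ (2 * (A * M + 1) + 1) * K := by
      calc 16 * θ ^ 2 * ‖S‖ * M ^ 2
          ≤ (2 * (A * M + 1) + 1) * (K * (1 / M) ^ 2) * M ^ 2 :=
            mul_le_mul_of_nonneg_right (hlow.trans hdiff) (by positivity)
        _ = (2 * (A * M + 1) + 1) * K := by field_simp
    have e2 : (2 * (A * M + 1) + 1) * K ≤ (2 * A + 3) * M * K :=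
      mul_le_mul_of_nonneg_right (by linarith) hK0
    have e3 : 0 ≤ θ ^ 2 * ‖S‖ * M ^ 2 := by positivity
    nlinarith
  rw [← mul_div_assoc, le_div_iff₀ (by positivity)]
  linarith

lemma sum_range_one_div_one_add_sq_le {x : ℝ} (hx : 0 < x) (N : ℕ) :
    ∑ n ∈ Finset.range N, 1 / (1 + (x * n) ^ 2) ≤ 1 + 2 / x := by
  have key : ∀ N : ℕ, ∑ n ∈ Finset.range (N + 1), 1 / (1 + (x * n) ^ 2) ≤
      1 + 2 / x * (1 - 1 / (1 + x * N)) := by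
    intro N
    induction N with
    | zero => simp
    | succ N ih =>
      rw [Finset.sum_range_succ]
      have hN : 0 ≤ x * N := by positivity
      have hstep : 1 / (1 + (x * (N + 1 : ℕ)) ^ 2) ≤
          2 / ((1 + x * N) * (1 + x * (N + 1 : ℕ))) := by
        push_cast
        rw [div_le_div_iff₀ (by positivity) (by positivity)]
        nlinarith [sq_nonneg (x * (N + 1) - 1)]
      have hid : 2 / x * (1 - 1 / (1 + x * (N + 1 : ℕ))) = 2 / x * (1 - 1 / (1 + x * N)) +
          2 / ((1 + x * N) * (1 + x * (N + 1 : ℕ))) := by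
        push_cast
        field_simp
        ring
      linarith
  have hmono : ∑ n ∈ Finset.range N, 1 / (1 + (x * n) ^ 2) ≤
      ∑ n ∈ Finset.range (N + 1), 1 / (1 + (x * n) ^ 2) :=
    Finset.sum_le_sum_of_subset_of_nonneg (Finset.range_mono N.le_succ)
      fun _ _ _ => by positivity
  refine hmono.trans ((key N).trans ?_)
  have h1 : 0 ≤ 1 / (1 + x * N) := by positivity
  have h2 : 0 < 2 / x := by positivity
  nlinarith

lemma sum_int_one_div_one_add_sq_le {x : ℝ} (hx : 0 < x) (s : Finset ℤ) :
    ∑ k ∈ s, 1 / (1 + (x * k) ^ 2) ≤ 2 * (1 + 2 / x) := by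
  classical
  set N := s.sup Int.natAbs + 1
  have hsub : s ⊆ (Finset.range N).image (fun n : ℕ => (n : ℤ)) ∪
      (Finset.range N).image (fun n : ℕ => -(n : ℤ)) := by
    intro k hk
    have hle : k.natAbs < N := Nat.lt_succ_of_le (Finset.le_sup (f := Int.natAbs) hk)
    rw [Finset.mem_union, Finset.mem_image, Finset.mem_image]
    rcases Int.natAbs_eq k with h | h
    · exact Or.inl ⟨k.natAbs, Finset.mem_range.mpr hle, h.symm⟩
    · exact Or.inr ⟨k.natAbs, Finset.mem_range.mpr hle, h.symm⟩
  have hnn : ∀ k : ℤ, 0 ≤ 1 / (1 + (x * k) ^ 2) := fun k => by positivity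
  refine (Finset.sum_le_sum_of_subset_of_nonneg hsub fun k _ _ => hnn k).trans ?_
  have hunion := Finset.sum_union_inter (s₁ := (Finset.range N).image (fun n : ℕ => (n : ℤ)))
    (s₂ := (Finset.range N).image (fun n : ℕ => -(n : ℤ)))
    (f := fun k : ℤ => 1 / (1 + (x * k) ^ 2))
  have hinter := Finset.sum_nonneg (s := (Finset.range N).image (fun n : ℕ => (n : ℤ)) ∩
    (Finset.range N).image (fun n : ℕ => -(n : ℤ))) fun k _ => hnn k
  rw [Finset.sum_image (by intro a _ b _ h; simpa using h),
    Finset.sum_image (by intro a _ b _ h; simpa using h)] at hunion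
  have hr := sum_range_one_div_one_add_sq_le hx N
  simp only [Int.cast_neg, Int.cast_natCast, mul_neg, neg_sq] at hunion
  linarith

/-- `√2` is badly approximable. -/
lemma one_div_four_mul_abs_le_abs_sqrt_two_mul_sub {q : ℤ} (hq : q ≠ 0) (p : ℤ) :
    1 / (4 * |(q : ℝ)|) ≤ |√2 * q - p| := by
  have hq1 : (1 : ℝ) ≤ |(q : ℝ)| := by exact_mod_cast Int.one_le_abs hq
  have h2 : √2 ^ 2 = 2 := Real.sq_sqrt (by norm_num)
  have hs : √2 ≤ 3 / 2 := by
    rw [Real.sqrt_le_left (by norm_num)]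
    norm_num
  rw [div_le_iff₀ (by positivity)]
  by_cases hc : 1 / 2 ≤ |√2 * q - p|
  · nlinarith
  push Not at hc
  have hne : 2 * q ^ 2 - p ^ 2 ≠ 0 := by
    intro h
    refine irrational_sqrt_two ⟨|(p : ℚ) / q|, ?_⟩
    have hqR : (q : ℝ) ≠ 0 := by exact_mod_cast hq
    have hR : 2 * (q : ℝ) ^ 2 - p ^ 2 = 0 := by exact_mod_cast h
    symm
    rw [Real.sqrt_eq_iff_mul_self_eq (by norm_num) (by positivity)]
    push_cast
    rw [abs_mul_abs_self]
    field_simp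
    linarith
  have hone : (1 : ℝ) ≤ |2 * (q : ℝ) ^ 2 - p ^ 2| := by exact_mod_cast Int.one_le_abs hne
  have hfac : 2 * (q : ℝ) ^ 2 - p ^ 2 = (√2 * q - p) * (√2 * q + p) := by
    linear_combination -(q : ℝ) ^ 2 * h2
  rw [hfac, abs_mul] at hone
  have hsum : |√2 * q + p| ≤ 4 * |(q : ℝ)| := by
    have h3 : |√2 * q + p| ≤ |2 * (√2 * q)| + |√2 * q - p| := by
      have := abs_sub (2 * (√2 * q)) (√2 * q - p)
      rwa [show 2 * (√2 * q) - (√2 * q - p) = √2 * q + p by ring] at this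
    rw [abs_mul, abs_mul, abs_of_pos (by norm_num : (0 : ℝ) < 2),
      abs_of_nonneg (Real.sqrt_nonneg 2)] at h3
    nlinarith
  exact hone.trans (mul_le_mul_of_nonneg_left hsum (abs_nonneg _))

/-- Summing `1 / (1 + (Mθ)²)` over `δ`-separated points `θ`. -/
lemma sum_one_div_one_add_sq_le_of_separated {ι : Type*} {s : Finset ι} {θ : ι → ℝ} {M δ : ℝ}
    (hM : 0 < M) (hδ : 0 < δ)
    (hsep : ∀ i ∈ s, ∀ j ∈ s, i ≠ j → δ ≤ |θ i - θ j|) :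
    ∑ i ∈ s, 1 / (1 + (M * θ i) ^ 2) ≤ 2 * (1 + 2 / (M * δ / 2)) := by
  classical
  have hinj : Set.InjOn (fun i => round (θ i / δ)) s := by
    intro i hi j hj hij
    by_contra hne
    have h := hsep i hi j hj hne
    have hi' := round_eq (θ i / δ) ▸ Int.floor_le (θ i / δ + 1 / 2)
    have hi'' := round_eq (θ i / δ) ▸ Int.lt_floor_add_one (θ i / δ + 1 / 2)
    have hj' := round_eq (θ j / δ) ▸ Int.floor_le (θ j / δ + 1 / 2)
    have hj'' := round_eq (θ j / δ) ▸ Int.lt_floor_add_one (θ j / δ + 1 / 2)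
    have hij' : (round (θ i / δ) : ℝ) = round (θ j / δ) := by exact_mod_cast hij
    have hlt : |θ i / δ - θ j / δ| < 1 := by
      rw [abs_lt]
      constructor <;> linarith
    rw [← sub_div, abs_div, abs_of_pos hδ, div_lt_one hδ] at hlt
    linarith
  have hterm : ∀ i ∈ s, 1 / (1 + (M * θ i) ^ 2) ≤
      1 / (1 + (M * δ / 2 * round (θ i / δ)) ^ 2) := by
    intro i _
    have hk : |(round (θ i / δ) : ℝ)| ≤ 2 * |θ i / δ| := by
      by_cases h0 : round (θ i / δ) = 0
      · rw [h0]
        simp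
      have h1 : (1 : ℝ) ≤ |(round (θ i / δ) : ℝ)| := by exact_mod_cast Int.one_le_abs h0
      have h2 := abs_sub_round (θ i / δ)
      have h3 := abs_sub_abs_le_abs_sub (round (θ i / δ) : ℝ) (θ i / δ)
      rw [abs_sub_comm] at h3
      linarith
    have hsq : (M * δ / 2 * round (θ i / δ)) ^ 2 ≤ (M * θ i) ^ 2 := by
      rw [sq_le_sq, abs_mul, abs_of_pos (by positivity : 0 < M * δ / 2), abs_mul, abs_of_pos hM]
      rw [abs_div, abs_of_pos hδ] at hk
      calc M * δ / 2 * |(round (θ i / δ) : ℝ)| ≤ M * δ / 2 * (2 * (|θ i| / δ)) :=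
            mul_le_mul_of_nonneg_left hk (by positivity)
        _ = M * |θ i| := by field_simp
    exact one_div_le_one_div_of_le (by positivity) (by linarith)
  calc ∑ i ∈ s, 1 / (1 + (M * θ i) ^ 2)
      ≤ ∑ i ∈ s, 1 / (1 + (M * δ / 2 * round (θ i / δ)) ^ 2) := Finset.sum_le_sum hterm
    _ = ∑ k ∈ s.image (fun i => round (θ i / δ)), 1 / (1 + (M * δ / 2 * k) ^ 2) :=
        (Finset.sum_image (f := fun k : ℤ => 1 / (1 + (M * δ / 2 * (k : ℝ)) ^ 2)) hinj).symm
    _ ≤ _ := sum_int_one_div_one_add_sq_le (by positivity) _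

/-- For smooth compactly supported `ρ₁, ρ₂ : ℝ → [0,1]` there is `C = C(ρ₁,ρ₂)` with
`|∑_{ℓ,ℓ' ∈ ℤ} ρ₁(ℓ/L) ρ₂(ℓ'/L') e(ℓψ) e(√2 ℓℓ')| ≤ C (L + L')` for all `L, L' ≥ 1`, `ψ ∈ ℝ`. -/
theorem bilinear_sqrt_two_sum_bound (ρ₁ ρ₂ : ℝ → ℝ)
    (hsmooth₁ : ContDiff ℝ (⊤ : ℕ∞) ρ₁) (hsupp₁ : HasCompactSupport ρ₁)
    (hrange₁ : ∀ x, ρ₁ x ∈ Set.Icc (0 : ℝ) 1)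
    (hsmooth₂ : ContDiff ℝ (⊤ : ℕ∞) ρ₂) (hsupp₂ : HasCompactSupport ρ₂)
    (hrange₂ : ∀ x, ρ₂ x ∈ Set.Icc (0 : ℝ) 1) :
    ∃ C : ℝ, ∀ L L' : ℝ, 1 ≤ L → 1 ≤ L' → ∀ ψ : ℝ,
      ‖∑' p : ℤ × ℤ, (ρ₁ (p.1 / L) * ρ₂ (p.2 / L') : ℂ) * eC (p.1 * ψ) *
          eC (Real.sqrt 2 * p.1 * p.2)‖ ≤ C * (L + L') := by
  have hunit : ∀ {ρ : ℝ → ℝ}, (∀ x, ρ x ∈ Set.Icc (0 : ℝ) 1) → ∀ x, |ρ x| ≤ 1 := fun h x =>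
    abs_le.mpr ⟨by linarith [(h x).1], (h x).2⟩
  obtain ⟨A, hA1, hA⟩ := hsupp₁.exists_forall_lt_abs_eq_zero
  obtain ⟨B, hB1, hB⟩ := hsupp₂.exists_forall_lt_abs_eq_zero
  obtain ⟨C, hC0, hC⟩ := exists_norm_smooth_exponential_sum_le
    (hsmooth₂.of_le (WithTop.coe_le_coe.mpr le_top)) hsupp₂ (hunit hrange₂)
  refine ⟨C * (64 * A), fun L M hL hM ψ => ?_⟩
  have hL0 : 0 < L := by linarith
  have hM0 : 0 < M := by linarith
  set s := Finset.Icc (-⌊A * L⌋) ⌊A * L⌋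
  set t := Finset.Icc (-⌊B * M⌋) ⌊B * M⌋
  have hvan₁ : ∀ n ∉ s, ρ₁ ((n : ℤ) / L) = 0 := fun n hn => hA _ (by
    rw [abs_div, abs_of_pos hL0, lt_div_iff₀ hL0]
    exact lt_abs_of_notMem_Icc_floor hn)
  have hvan₂ : ∀ n ∉ t, ρ₂ ((n : ℤ) / M) = 0 := fun n hn => hB _ (by
    rw [abs_div, abs_of_pos hM0, lt_div_iff₀ hM0]
    exact lt_abs_of_notMem_Icc_floor hn)
  have hsum : ∑' p : ℤ × ℤ, (ρ₁ (p.1 / L) * ρ₂ (p.2 / M) : ℂ) * eC (p.1 * ψ) *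
      eC (√2 * p.1 * p.2) = ∑ l ∈ s, (ρ₁ (l / L) : ℂ) * eC (l * ψ) *
        ∑' n : ℤ, (ρ₂ (n / M) : ℂ) * eC (√2 * l) ^ n := by
    rw [tsum_eq_sum (s := s ×ˢ t), Finset.sum_product]
    · refine Finset.sum_congr rfl fun l _ => ?_
      rw [tsum_eq_sum (s := t) (fun n hn => by rw [hvan₂ n hn]; simp), Finset.mul_sum]
      refine Finset.sum_congr rfl fun n _ => ?_
      rw [eC_mul_intCast]
      ring
    · rintro ⟨l, n⟩ hp
      rw [Finset.mem_product, not_and_or] at hp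
      rcases hp with h | h
      · simp [hvan₁ l h]
      · simp [hvan₂ n h]
  set θ : ℤ → ℝ := fun l => √2 * l - round (√2 * l) with hθ
  have hterm : ∀ l ∈ s, ‖(ρ₁ (l / L) : ℂ) * eC (l * ψ) *
      ∑' n : ℤ, (ρ₂ (n / M) : ℂ) * eC (√2 * l) ^ n‖ ≤ C * M * (1 / (1 + (M * θ l) ^ 2)) := by
    intro l _
    rw [norm_mul, norm_mul, norm_eC, mul_one, Complex.norm_real]
    calc _ ≤ 1 * _ := mul_le_mul_of_nonneg_right (hunit hrange₁ _) (norm_nonneg _)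
      _ ≤ C * (M / (1 + (M * θ l) ^ 2)) := by
          rw [one_mul]
          exact hC M hM _
      _ = _ := by ring
  have hsep : ∀ i ∈ s, ∀ j ∈ s, i ≠ j → 1 / (8 * (A * L)) ≤ |θ i - θ j| := by
    intro i hi j hj hij
    have hbd : ∀ k ∈ s, |(k : ℝ)| ≤ A * L := fun k hk => by
      have h := Int.le_floor.mp (abs_le.mpr (Finset.mem_Icc.mp hk))
      simpa using h
    have hne := sub_ne_zero.mpr hij
    have h := one_div_four_mul_abs_le_abs_sqrt_two_mul_sub hne (round (√2 * i) - round (√2 * j))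
    have habs : |((i - j : ℤ) : ℝ)| ≤ 2 * (A * L) := by
      push_cast
      linarith [abs_sub (i : ℝ) j, hbd i hi, hbd j hj]
    have hpos : 0 < |((i - j : ℤ) : ℝ)| := abs_pos.mpr (by exact_mod_cast hne)
    calc 1 / (8 * (A * L)) ≤ 1 / (4 * |((i - j : ℤ) : ℝ)|) :=
          one_div_le_one_div_of_le (by positivity) (by linarith)
      _ ≤ _ := h
      _ = |θ i - θ j| := by
          congr 1
          simp only [hθ]
          push_cast
          ring
  have hAM : 2 * M + 64 * A * L ≤ 64 * A * (L + M) := by nlinarith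
  have hfinal := sum_one_div_one_add_sq_le_of_separated hM0 (by positivity) hsep
  rw [hsum]
  calc _ ≤ ∑ l ∈ s, C * M * (1 / (1 + (M * θ l) ^ 2)) := norm_sum_le_of_le _ hterm
    _ = C * M * ∑ l ∈ s, 1 / (1 + (M * θ l) ^ 2) := by rw [Finset.mul_sum]
    _ ≤ C * M * (2 * (1 + 2 / (M * (1 / (8 * (A * L))) / 2))) :=
        mul_le_mul_of_nonneg_left hfinal (mul_nonneg hC0 hM0.le)
    _ = C * (2 * M + 64 * A * L) := by
        field_simp
        ring
    _ ≤ C * (64 * A) * (L + M) := by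
        rw [mul_assoc C]
        exact mul_le_mul_of_nonneg_left hAM hC0
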